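/- arXiv:1508.01736 — 3 statements merged into one kernel-verified Lean document; each statement's English description precedes it below -/
import Mathlib

section
/- Let (x_o, y_o) ∈ T_BCC. Then θ_CCR(o) = 1 if and only if (x_o, y_o) is MPSS. (In particular, θ_CCR(o) ≤ 1 always holds for points of T_BCC.) -/
open Matrix

/-- For (x_o, y_o) ∈ T_BCC, θ_CCR(o) ≤ 1, and θ_CCR(o) = 1 iff (x_o, y_o) is MPSS. -/
theorem ccr_score_one_iff_mpss
    {m s n : ℕ}
    (X : Matrix (Fin m) (Fin n) ℝ) (Y : Matrix (Fin s) (Fin n) ℝ)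
    (hX : ∀ i j, 0 ≤ X i j) (hY : ∀ r j, 0 ≤ Y r j)
    (xo : Fin m → ℝ) (yo : Fin s → ℝ)
    (hxo : ∀ i, 0 < xo i) (hyo : ∀ r, 0 ≤ yo r) (hyo0 : yo ≠ 0)
    (T : Set ((Fin m → ℝ) × (Fin s → ℝ)))
    (hT : T = {p | ∃ lam : Fin n → ℝ, (∀ j, 0 ≤ lam j) ∧ (∑ j, lam j) = 1 ∧
        (∀ i, X.mulVec lam i ≤ p.1 i) ∧ (∀ r, p.2 r ≤ Y.mulVec lam r)})
    (θ : ℝ)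
    (hθ : θ = sInf {t : ℝ | ∃ lam : Fin n → ℝ, (∀ j, 0 ≤ lam j) ∧
        (∀ i, X.mulVec lam i ≤ t * xo i) ∧ (∀ r, yo r ≤ Y.mulVec lam r)})
    (hmem : (xo, yo) ∈ T) :
    θ ≤ 1 ∧
      (θ = 1 ↔ ∀ α β : ℝ, 0 < α → 0 < β → (β • xo, α • yo) ∈ T → α ≤ β) := by
  subst hT
  set S : Set ℝ := {t : ℝ | ∃ lam : Fin n → ℝ, (∀ j, 0 ≤ lam j) ∧
        (∀ i, X.mulVec lam i ≤ t * xo i) ∧ (∀ r, yo r ≤ Y.mulVec lam r)} with hS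
  have h1 : (1 : ℝ) ∈ S := by
    obtain ⟨lam, h0, _, hx, hy⟩ := hmem
    exact ⟨lam, h0, fun i => by simpa using hx i, hy⟩
  have hle : θ ≤ 1 := by
    rw [hθ]
    by_cases hb : BddBelow S
    · exact csInf_le hb h1
    · rw [Real.sInf_of_not_bddBelow hb]; exact zero_le_one
  refine ⟨hle, ?_, ?_⟩
  · intro h α β hα hβ hm
    have hb : BddBelow S := by
      by_contra hb
      rw [Real.sInf_of_not_bddBelow hb] at hθ
      linarith
    obtain ⟨lam, h0, _, hx, hy⟩ := hm
    have hmemS : β / α ∈ S := by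
      refine ⟨α⁻¹ • lam, fun j => ?_, fun i => ?_, fun r => ?_⟩
      · exact mul_nonneg (inv_nonneg.2 hα.le) (h0 j)
      · have := mul_le_mul_of_nonneg_left (hx i) (inv_nonneg.2 hα.le)
        rw [Matrix.mulVec_smul]
        simp only [Pi.smul_apply, smul_eq_mul] at this ⊢
        calc _ ≤ _ := this
          _ = _ := by ring
      · have := mul_le_mul_of_nonneg_left (hy r) (inv_nonneg.2 hα.le)
        rw [Matrix.mulVec_smul]
        simp only [Pi.smul_apply, smul_eq_mul] at this ⊢
        calc yo r = α⁻¹ * (α * yo r) := by field_simp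
          _ ≤ _ := this
    have h2 := csInf_le hb hmemS
    rw [← hθ, h, le_div_iff₀ hα] at h2
    linarith
  · intro h
    by_contra hne
    have hlt : sInf S < 1 := by rw [← hθ]; exact lt_of_le_of_ne hle hne
    obtain ⟨t, ⟨lam, h0, hx, hy⟩, ht⟩ := exists_lt_of_csInf_lt ⟨1, h1⟩ hlt
    have hσ : 0 < ∑ j, lam j := by
      refine lt_of_le_of_ne (Finset.sum_nonneg fun j _ => h0 j) fun hz => hyo0 ?_
      have hl : lam = 0 := by
        funext j
        exact (Finset.sum_eq_zero_iff_of_nonneg fun j _ => h0 j).1 hz.symm j (Finset.mem_univ j)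
      funext r
      have := hy r
      rw [hl, Matrix.mulVec_zero] at this
      exact le_antisymm this (hyo r)
    set σ := ∑ j, lam j with hσd
    have hi : 0 < σ⁻¹ := inv_pos.2 hσ
    have ht' : 0 < max t (1 / 2) := lt_max_of_lt_right (by norm_num)
    have ht1 : max t (1 / 2) < 1 := max_lt ht (by norm_num)
    have key := h σ⁻¹ (σ⁻¹ * max t (1 / 2)) hi (mul_pos hi ht') (by
      refine ⟨σ⁻¹ • lam, fun j => mul_nonneg hi.le (h0 j), ?_, fun i => ?_, fun r => ?_⟩
      · simp only [Pi.smul_apply, smul_eq_mul]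
        rw [← Finset.mul_sum, ← hσd, inv_mul_cancel₀ hσ.ne']
      · rw [Matrix.mulVec_smul]
        simp only [Pi.smul_apply, smul_eq_mul]
        rw [mul_assoc]
        exact mul_le_mul_of_nonneg_left ((hx i).trans
          (mul_le_mul_of_nonneg_right (le_max_left _ _) (hxo i).le)) hi.le
      · rw [Matrix.mulVec_smul]
        simp only [Pi.smul_apply, smul_eq_mul]
        exact mul_le_mul_of_nonneg_left (hy r) hi.le)
    nlinarith
end

section
/- Every element of the projection set Λ_o is BCC-efficient: if λ ∈ F maximizes the slack-sum g on F, then there is no (x,y) ∈ T_BCC with x ≤ Xλ, y ≥ Yλ and (x,y) ≠ (Xλ, Yλ). -/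
open Matrix

/-- Every element of the (maximum-slack) projection set Λ_o is BCC-efficient. -/
theorem projection_points_are_bcc_efficient
    {m s n : ℕ}
    (X : Matrix (Fin m) (Fin n) ℝ) (Y : Matrix (Fin s) (Fin n) ℝ)
    (hX : ∀ i j, 0 ≤ X i j) (hY : ∀ r j, 0 ≤ Y r j)
    (xo : Fin m → ℝ) (yo : Fin s → ℝ)
    (hxo : ∀ i, 0 < xo i) (hyo : ∀ r, 0 ≤ yo r) (hyo0 : yo ≠ 0)
    (T : Set ((Fin m → ℝ) × (Fin s → ℝ)))
    (hT : T = {p | ∃ lam : Fin n → ℝ, (∀ j, 0 ≤ lam j) ∧ (∑ j, lam j) = 1 ∧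
        (∀ i, X.mulVec lam i ≤ p.1 i) ∧ (∀ r, p.2 r ≤ Y.mulVec lam r)})
    (θStar : ℝ)
    (hθ : θStar = sInf {t : ℝ | ∃ lam : Fin n → ℝ, (∀ j, 0 ≤ lam j) ∧ (∑ j, lam j) = 1 ∧
        (∀ i, X.mulVec lam i ≤ t * xo i) ∧ (∀ r, yo r ≤ Y.mulVec lam r)})
    (F : Set (Fin n → ℝ))
    (hF : F = {lam | (∀ j, 0 ≤ lam j) ∧ (∑ j, lam j) = 1 ∧
        (∀ i, X.mulVec lam i ≤ θStar * xo i) ∧ (∀ r, yo r ≤ Y.mulVec lam r)})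
    (g : (Fin n → ℝ) → ℝ)
    (hg : g = fun lam =>
        (∑ i, (θStar * xo i - X.mulVec lam i)) + ∑ r, (Y.mulVec lam r - yo r))
    (lam : Fin n → ℝ) (hlam : lam ∈ F)
    (hmax : ∀ lam' ∈ F, g lam' ≤ g lam) :
    ¬ ∃ p ∈ T, (∀ i, p.1 i ≤ X.mulVec lam i) ∧ (∀ r, Y.mulVec lam r ≤ p.2 r) ∧
        p ≠ (X.mulVec lam, Y.mulVec lam) := by
  subst hF hT hg
  rintro ⟨⟨x, y⟩, ⟨μ, h0, h1, hx, hy⟩, hpx, hpy, hne⟩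
  obtain ⟨_, _, hlx, hly⟩ := hlam
  dsimp only at hx hy hpx hpy
  have key := hmax μ ⟨h0, h1, fun i => ((hx i).trans (hpx i)).trans (hlx i),
    fun r => ((hly r).trans (hpy r)).trans (hy r)⟩
  simp only [Finset.sum_sub_distrib] at key
  have nx : ∀ i ∈ Finset.univ, 0 ≤ (X.mulVec lam i - X.mulVec μ i) :=
    fun i _ => sub_nonneg.2 ((hx i).trans (hpx i))
  have ny : ∀ r ∈ Finset.univ, 0 ≤ (Y.mulVec μ r - Y.mulVec lam r) :=
    fun r _ => sub_nonneg.2 ((hpy r).trans (hy r))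
  have sx := Finset.sum_nonneg nx
  have sy := Finset.sum_nonneg ny
  have zx : ∑ i, (X.mulVec lam i - X.mulVec μ i) = 0 := by
    simp only [Finset.sum_sub_distrib] at sx sy ⊢
    linarith
  have zy : ∑ r, (Y.mulVec μ r - Y.mulVec lam r) = 0 := by
    simp only [Finset.sum_sub_distrib] at sx sy ⊢
    linarith
  rw [Finset.sum_eq_zero_iff_of_nonneg nx] at zx
  rw [Finset.sum_eq_zero_iff_of_nonneg ny] at zy
  apply hne
  refine Prod.ext (funext fun i => ?_) (funext fun r => ?_)
  · have := zx i (Finset.mem_univ i)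
    exact le_antisymm (hpx i) (by linarith [hx i])
  · have := zy r (Finset.mem_univ r)
    exact le_antisymm (by linarith [hy r]) (hpy r)
end

section
/- Let A be a real k×e matrix, b ∈ ℝ^k with b ≠ 0, and suppose S = {μ ∈ ℝ^e : μ ≥ 0, Aμ = b} is nonempty. Consider the linear program: maximize ∑_{i=1}^e μ¹_i + δ¹ over variables μ¹, μ² ∈ ℝ^e and δ¹, δ² ∈ ℝ subject to A(μ¹ + μ²) = (δ¹ + δ²)·b, 0 ≤ μ¹_i ≤ 1 for all i, 0 ≤ δ¹ ≤ 1, μ² ≥ 0, δ² ≥ 0. Then (a) this program has an optimal solution; (b) every optimal solution satisfies δ¹ = 1; and (c) for every optimal solution, the vector μ^max := (μ¹ + μ²)/(1 + δ²) belongs to S and its support {i : μ^max_i > 0} equals ⋃_{μ ∈ S} {i : μ_i > 0}, i.e., μ^max is a maximal element of S. -/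
open Matrix

/-- A candidate solution of the linear program (7): `(μ¹, μ², δ¹, δ²)`. -/
structure LPSol (e : ℕ) where
  mu1 : Fin e → ℝ
  mu2 : Fin e → ℝ
  d1 : ℝ
  d2 : ℝ

/-- Feasibility for the linear program (7). -/
def LPFeasible {k e : ℕ} (A : Matrix (Fin k) (Fin e) ℝ) (b : Fin k → ℝ)
    (p : LPSol e) : Prop :=
  A.mulVec (p.mu1 + p.mu2) = (p.d1 + p.d2) • b ∧
  (∀ i, 0 ≤ p.mu1 i ∧ p.mu1 i ≤ 1) ∧ (0 ≤ p.d1 ∧ p.d1 ≤ 1) ∧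
  (∀ i, 0 ≤ p.mu2 i) ∧ 0 ≤ p.d2

/-- Objective function of the linear program (7). -/
def LPObj {e : ℕ} (p : LPSol e) : ℝ := (∑ i, p.mu1 i) + p.d1

/-- The LP (7) has an optimal solution; every optimal solution has δ¹ = 1;
and for every optimal solution, μ^max = (μ¹ + μ²)/(1 + δ²) is a maximal element of
S = {μ ≥ 0 : Aμ = b}. -/
theorem lp_yields_maximal_element
    {k e : ℕ} (A : Matrix (Fin k) (Fin e) ℝ) (b : Fin k → ℝ) (hb : b ≠ 0)
    (S : Set (Fin e → ℝ))
    (hS : S = {μ | (∀ i, 0 ≤ μ i) ∧ A.mulVec μ = b})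
    (hSne : S.Nonempty) :
    (∃ p : LPSol e, LPFeasible A b p ∧ ∀ q : LPSol e, LPFeasible A b q → LPObj q ≤ LPObj p) ∧
    (∀ p : LPSol e, LPFeasible A b p → (∀ q : LPSol e, LPFeasible A b q → LPObj q ≤ LPObj p) →
      p.d1 = 1 ∧
      (1 / (1 + p.d2)) • (p.mu1 + p.mu2) ∈ S ∧
      {i | 0 < ((1 / (1 + p.d2)) • (p.mu1 + p.mu2)) i} = ⋃ μ ∈ S, {i | 0 < μ i}) := by
  classical
  have memS : ∀ μ, μ ∈ S ↔ (∀ i, 0 ≤ μ i) ∧ A.mulVec μ = b := by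
    intro μ; rw [hS]; rfl
  -- a maximal element of S
  obtain ⟨ν, hν0, hνb, hνmax⟩ : ∃ ν : Fin e → ℝ, (∀ i, 0 ≤ ν i) ∧ A.mulVec ν = b ∧
      ∀ μ ∈ S, ∀ i, 0 < μ i → 0 < ν i := by
    obtain ⟨μ0, hμ0⟩ := hSne
    have hch : ∀ i : Fin e, ∃ m ∈ S, ∀ μ ∈ S, 0 < μ i → 0 < m i := by
      intro i
      by_cases h : ∃ m ∈ S, 0 < m i
      · obtain ⟨m, hm, hmi⟩ := h
        exact ⟨m, hm, fun _ _ _ => hmi⟩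
      · exact ⟨μ0, hμ0, fun μ hμ hi => absurd ⟨μ, hμ, hi⟩ h⟩
    choose m hmS hm using hch
    have hpos : (0 : ℝ) < 1 + e := by positivity
    have h0 := (memS μ0).1 hμ0
    have hm' := fun i => (memS (m i)).1 (hmS i)
    refine ⟨(1 / (1 + e : ℝ)) • (μ0 + ∑ i, m i), ?_, ?_, ?_⟩
    · intro i
      simp only [Pi.smul_apply, Pi.add_apply, Finset.sum_apply, smul_eq_mul]
      exact mul_nonneg (by positivity)
        (add_nonneg (h0.1 i) (Finset.sum_nonneg fun j _ => (hm' j).1 i))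
    · have hs : A.mulVec (∑ i, m i) = (e : ℝ) • b := by
        have h1 := map_sum A.mulVecLin m Finset.univ
        simp only [Matrix.mulVecLin_apply] at h1
        rw [h1, Finset.sum_congr rfl (fun i _ => (hm' i).2)]
        ext j
        simp
      rw [Matrix.mulVec_smul, Matrix.mulVec_add, hs, h0.2]
      ext j
      simp only [Pi.smul_apply, Pi.add_apply, smul_eq_mul]
      field_simp
    · intro μ hμ i hi
      simp only [Pi.smul_apply, Pi.add_apply, Finset.sum_apply, smul_eq_mul]
      refine mul_pos (by positivity) (add_pos_of_nonneg_of_pos (h0.1 i) ?_)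
      exact lt_of_lt_of_le (hm i μ hμ hi)
        (Finset.single_le_sum (f := fun j => m j i) (fun j _ => (hm' j).1 i) (Finset.mem_univ i))
  have hνS : ν ∈ S := (memS ν).2 ⟨hν0, hνb⟩
  -- support of any feasible solution lies in the support of ν
  have hsupp : ∀ q : LPSol e, LPFeasible A b q → ∀ i, 0 < q.mu1 i + q.mu2 i → 0 < ν i := by
    rintro q ⟨hA, h1, hd1, h2, hd2⟩ i hi
    have ht : 0 < 1 + (q.d1 + q.d2) := by linarith [hd1.1]
    refine hνmax ((1 / (1 + (q.d1 + q.d2))) • (ν + (q.mu1 + q.mu2))) ((memS _).2 ⟨?_, ?_⟩) i ?_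
    · intro j
      simp only [Pi.smul_apply, Pi.add_apply, smul_eq_mul]
      exact mul_nonneg (by positivity)
        (add_nonneg (hν0 j) (add_nonneg (h1 j).1 (h2 j)))
    · rw [Matrix.mulVec_smul, Matrix.mulVec_add, hA, hνb]
      ext j
      simp only [Pi.smul_apply, Pi.add_apply, smul_eq_mul]
      field_simp
    · simp only [Pi.smul_apply, Pi.add_apply, smul_eq_mul]
      exact mul_pos (by positivity) (add_pos_of_nonneg_of_pos (hν0 i) hi)
  let χ : Fin e → ℝ := fun i => if 0 < ν i then 1 else 0
  have hle : ∀ q : LPSol e, LPFeasible A b q → ∀ i, q.mu1 i ≤ χ i := by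
    intro q hq i
    by_cases h : 0 < ν i
    · simpa [χ, h] using (hq.2.1 i).2
    · simp only [χ, h, if_false]
      by_contra hc
      exact h (hsupp q hq i (by linarith [hq.2.2.2.1 i]))
  let N : ℝ := 1 + ∑ i, (ν i)⁻¹
  have hinv : ∀ i, 0 ≤ (ν i)⁻¹ := fun i => inv_nonneg.2 (hν0 i)
  have hN : 0 ≤ N - 1 := by
    simpa [N] using Finset.sum_nonneg fun i (_ : i ∈ Finset.univ) => hinv i
  let p0 : LPSol e := ⟨χ, N • ν - χ, 1, N - 1⟩
  have hp0 : LPFeasible A b p0 := by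
    refine ⟨?_, ?_, ⟨zero_le_one, le_refl _⟩, ?_, hN⟩
    · simp [p0, Matrix.mulVec_smul, hνb]
    · intro i
      simp only [p0, χ]
      split_ifs <;> norm_num
    · intro i
      simp only [p0, χ, Pi.sub_apply, Pi.smul_apply, smul_eq_mul]
      split_ifs with h
      · have h3 : (ν i)⁻¹ ≤ N := by
          have := Finset.single_le_sum (f := fun j => (ν j)⁻¹) (fun j _ => hinv j)
            (Finset.mem_univ i)
          simp only [N]
          linarith
        have h4 := mul_le_mul_of_nonneg_right h3 h.le
        rw [inv_mul_cancel₀ h.ne'] at h4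
        linarith
      · have := mul_nonneg (by linarith : 0 ≤ N) (hν0 i)
        linarith
  refine ⟨⟨p0, hp0, fun q hq => ?_⟩, fun p hp hopt => ?_⟩
  · exact add_le_add (Finset.sum_le_sum fun i _ => hle q hq i) hq.2.2.1.2
  · have ho : (∑ i, χ i) + 1 ≤ (∑ i, p.mu1 i) + p.d1 := hopt p0 hp0
    have hs : ∑ i, p.mu1 i ≤ ∑ i, χ i := Finset.sum_le_sum fun i _ => hle p hp i
    have hd : p.d1 = 1 := le_antisymm hp.2.2.1.2 (by linarith)
    have hse : ∑ i, p.mu1 i = ∑ i, χ i := le_antisymm hs (by linarith [hp.2.2.1.2])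
    have hmu : ∀ i, p.mu1 i = χ i := fun i =>
      (Finset.sum_eq_sum_iff_of_le fun i _ => hle p hp i).1 hse i (Finset.mem_univ i)
    obtain ⟨hA, h1, -, h2, hd2⟩ := id hp
    have ht : 0 < 1 + p.d2 := by linarith
    refine ⟨hd, (memS _).2 ⟨?_, ?_⟩, ?_⟩
    · intro j
      simp only [Pi.smul_apply, Pi.add_apply, smul_eq_mul]
      exact mul_nonneg (by positivity) (add_nonneg (h1 j).1 (h2 j))
    · rw [Matrix.mulVec_smul, hA, hd, smul_smul, one_div, inv_mul_cancel₀ ht.ne', one_smul]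
    · ext i
      simp only [Set.mem_setOf_eq, Set.mem_iUnion, Pi.smul_apply, Pi.add_apply, smul_eq_mul,
        exists_prop]
      constructor
      · intro h
        exact ⟨ν, hνS, hsupp p hp i (pos_of_mul_pos_right h (by positivity))⟩
      · rintro ⟨μ, hμ, hi⟩
        have h5 : p.mu1 i = 1 := by rw [hmu i]; simp [χ, hνmax μ hμ i hi]
        exact mul_pos (by positivity) (by linarith [h2 i])
end
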